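/- arXiv:2501.18445 — 3 statements merged into one kernel-verified Lean document; each statement's English description precedes it below -/
import Mathlib

section
/- Let A = (Q, q0, δ, safe(F)) be a deterministic safety automaton over Σ. The universal controller U = (Q, q0, δ, κ) whose prophecy annotation is given by the safe prophecies, κ(q, α) = S_A^{q,α}, is correct for L(A): for every plant M_p that is admissible for L(A) and every controller M_c, if M_c ⊨ U ∥ M_p then M_p ∥ M_c ⊨ L(A). -/
/- Common framework: Moore machines (strategies), parallel composition of a
plant and a controller, deterministic safety automata, runs, languages,
safe prophecies, universal controllers and consistency, tree automata. -/

namespace UCS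

/-- A Moore machine (strategy) over input propositions `I` and output
propositions `O`, both subsets of the atomic propositions `AP`.
Inputs fed to the transition function are subsets of `I` (we always
intersect with `I` before feeding letters). -/
structure Moore (AP : Type) (I O : Set AP) where
  S : Type
  fin : Finite S
  s0 : S
  tr : S → Set AP → S
  out : S → Set AP
  out_sub : ∀ s, out s ⊆ O

namespace Moore

variable {AP : Type} {I O : Set AP}

/-- The state of `M` after reading the first `n` letters of `γ↓_I`. -/
def stateSeq (M : Moore AP I O) (γ : ℕ → Set AP) : ℕ → M.S
  | 0 => M.s0
  | n + 1 => M.tr (stateSeq M γ n) (γ n ∩ I)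

/-- Traces of `M`: traces `γ ∈ Σ^ω` such that on input `γ↓_I` the machine
produces the output sequence `γ↓_O`. -/
def Traces (M : Moore AP I O) : Set (ℕ → Set AP) :=
  {γ | ∀ i, M.out (M.stateSeq γ i) = γ i ∩ O}

/-- `M ⊨ L` iff `Traces(M) ⊆ L`. -/
def Sat (M : Moore AP I O) (L : Set (ℕ → Set AP)) : Prop :=
  M.Traces ⊆ L

/-- `out(M, γ)`: output of the last state of the path of `M` on the finite
input sequence `γ`. -/
def outOf (M : Moore AP I O) (γ : List (Set AP)) : Set AP :=
  M.out (γ.foldl (fun s a => M.tr s (a ∩ I)) M.s0)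

/-- `M(s)`: the machine `M` with its initial state replaced by `s`. -/
def reinit (M : Moore AP I O) (s : M.S) : Moore AP I O :=
  { M with s0 := s }

end Moore

variable {AP : Type}

/-- Parallel composition `M_p ∥ M_c` of a plant and a controller: a Moore
machine over inputs `O_e` and outputs `O_p ∪ O_c`. -/
@[reducible] def par {Oe Oc Op : Set AP} (Mp : Moore AP (Oe ∪ Oc) Op)
    (Mc : Moore AP (Oe ∪ Op) Oc) : Moore AP Oe (Op ∪ Oc) where
  S := Mp.S × Mc.S
  fin := by haveI := Mp.fin; haveI := Mc.fin; exact inferInstance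
  s0 := (Mp.s0, Mc.s0)
  tr := fun p σ =>
    (Mp.tr p.1 ((σ ∪ Mc.out p.2) ∩ (Oe ∪ Oc)),
     Mc.tr p.2 ((σ ∪ Mp.out p.1) ∩ (Oe ∪ Op)))
  out := fun p => Mp.out p.1 ∪ Mc.out p.2
  out_sub := fun p => Set.union_subset_union (Mp.out_sub p.1) (Mc.out_sub p.2)

/-- A deterministic safety automaton `(Q, q0, δ, safe(F))` over `Σ = 2^AP`. -/
structure DSA (AP : Type) where
  Q : Type
  fin : Finite Q
  q0 : Q
  δ : Q → Set AP → Q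
  F : Set Q

namespace DSA

/-- The unique run of `A` from state `q` on the trace `γ`. -/
def run (A : DSA AP) (q : A.Q) (γ : ℕ → Set AP) : ℕ → A.Q
  | 0 => q
  | n + 1 => A.δ (run A q γ n) (γ n)

/-- `L(A)`: the traces whose run from `q0` stays in the safe states `F`. -/
def Lang (A : DSA AP) : Set (ℕ → Set AP) :=
  {γ | ∀ i, A.run A.q0 γ i ∈ A.F}

/-- `Runs(A, q, M)`: runs of `A` from `q` on traces of `M`. -/
def Runs {I O : Set AP} (A : DSA AP) (q : A.Q) (M : Moore AP I O) :
    Set (ℕ → A.Q) :=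
  {ρ | ∃ γ ∈ M.Traces, ρ = A.run q γ}

end DSA

/-- The safe prophecy `S_A^{q,α}`: all plants `M_p` for which there exists a
controller `M_c` with `out(M_c, ε) = α` such that every run in
`Runs(A, q, M_p ∥ M_c)` is accepting. -/
def safeProphecy (Oe Oc Op : Set AP) (A : DSA AP) (q : A.Q) (α : Set AP) :
    Set (Moore AP (Oe ∪ Oc) Op) :=
  {Mp | ∃ Mc : Moore AP (Oe ∪ Op) Oc, Mc.outOf [] = α ∧
    ∀ ρ ∈ A.Runs q (par Mp Mc), ∀ i, ρ i ∈ A.F}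

/-- A plant is admissible for `L` iff some controller together with it
satisfies `L`. -/
def Admissible {Oe Oc Op : Set AP} (Mp : Moore AP (Oe ∪ Oc) Op)
    (L : Set (ℕ → Set AP)) : Prop :=
  ∃ Mc : Moore AP (Oe ∪ Op) Oc, (par Mp Mc).Sat L

/-- Reachable states of the product of a transition structure
`(SU, u0, trU)` reading full letters of `Σ` with a Moore machine `M` over
inputs `O_e`: `((u, s), σ) ↦ (trU u (σ ∪ out(s)), tr s σ)` for `σ ⊆ O_e`. -/
inductive ProdReach {AP : Type} (Oe : Set AP) {SU : Type}
    (trU : SU → Set AP → SU) (u0 : SU) {O : Set AP} (M : Moore AP Oe O) :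
    SU × M.S → Prop
  | init : ProdReach Oe trU u0 M (u0, M.s0)
  | step (u : SU) (s : M.S) (σ : Set AP) :
      σ ⊆ Oe → ProdReach Oe trU u0 M (u, s) →
      ProdReach Oe trU u0 M (trU u (σ ∪ M.out s), M.tr s σ)

/-- A run of the product `A × M` from the initial state on the environment
input sequence `β`. -/
def prodRun {Oe O : Set AP} (A : DSA AP) (M : Moore AP Oe O)
    (β : ℕ → Set AP) : ℕ → A.Q × M.S
  | 0 => (A.q0, M.s0)
  | n + 1 =>
      (A.δ (prodRun A M β n).1 (β n ∪ M.out (prodRun A M β n).2),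
       M.tr (prodRun A M β n).2 (β n))

/-- A universal controller `(S, s0, τ, κ)` over `Σ` with prophecy
annotation `κ` assigning sets of plants. -/
structure UnivController (AP : Type) (Oe Oc Op : Set AP) where
  S : Type
  fin : Finite S
  s0 : S
  tr : S → Set AP → S
  κ : S → Set AP → Set (Moore AP (Oe ∪ Oc) Op)

/-- `M_c ⊨ U ∥ M_p`: for every state `(s, s_p, s_c)` reachable in the
product `U × (M_p ∥ M_c)`, `M_p(s_p) ∈ κ(s, o_c(s_c))`. -/
def Consistent {Oe Oc Op : Set AP} (U : UnivController AP Oe Oc Op)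
    (Mp : Moore AP (Oe ∪ Oc) Op) (Mc : Moore AP (Oe ∪ Op) Oc) : Prop :=
  ∀ (u : U.S) (sp : Mp.S) (sc : Mc.S),
    ProdReach Oe U.tr U.s0 (par Mp Mc) (u, (sp, sc)) →
    Mp.reinit sp ∈ U.κ u (Mc.out sc)

/-- The universal controller `(Q, q0, δ, κ)` over the state space of `A`
whose prophecy annotation is given by the safe prophecies. -/
def safeUC (Oe Oc Op : Set AP) (A : DSA AP) : UnivController AP Oe Oc Op where
  S := A.Q
  fin := A.fin
  s0 := A.q0
  tr := A.δ
  κ := fun q α => safeProphecy Oe Oc Op A q α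

/-- A tree automaton over `2^O`-labeled `2^I`-trees. -/
structure TreeAut (AP : Type) (I O : Set AP) where
  Q : Type
  fin : Finite Q
  q0 : Q
  T : Set (Q × Set AP × (Set AP → Q))
  Ω : Set (ℕ → Q)

namespace TreeAut

variable {AP : Type} {I O : Set AP}

/-- `η` is a run of the tree automaton on the tree `t`. -/
def IsRun (A' : TreeAut AP I O) (t : List (Set AP) → Set AP)
    (η : List (Set AP) → A'.Q) : Prop :=
  η [] = A'.q0 ∧
  ∀ γ : List (Set AP), (∀ a ∈ γ, a ⊆ I) →
    ∃ f : Set AP → A'.Q, (A'.T (η γ, t γ, f)) ∧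
      ∀ α : Set AP, α ⊆ I → η (γ ++ [α]) = f α

/-- `η` is an accepting run: every path it produces (along any input
sequence in `(2^I)^ω`) belongs to `Ω`. -/
def IsAcceptingRun (A' : TreeAut AP I O) (t : List (Set AP) → Set AP)
    (η : List (Set AP) → A'.Q) : Prop :=
  A'.IsRun t η ∧
  ∀ α : ℕ → Set AP, (∀ i, α i ⊆ I) →
    (fun n => η (List.ofFn fun i : Fin n => α i)) ∈ A'.Ω

/-- The language of the tree automaton: all trees admitting an accepting
run. -/
def Lang (A' : TreeAut AP I O) : Set (List (Set AP) → Set AP) :=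
  {t | ∃ η, A'.IsAcceptingRun t η}

end TreeAut

variable {AP : Type}

/-- A Moore machine with disjoint inputs and outputs has a trace: feed it empty inputs. -/
theorem Moore.traces_nonempty {I O : Set AP} (M : Moore AP I O) (h : Disjoint I O) :
    M.Traces.Nonempty := by
  let t : ℕ → M.S := fun n => (fun s => M.tr s ∅)^[n] M.s0
  have hI (n : ℕ) : M.out (t n) ∩ I = ∅ :=
    ((h.mono_right (M.out_sub (t n))).symm).inter_eq
  have hst (n : ℕ) : M.stateSeq (fun n => M.out (t n)) n = t n := by
    induction n with
    | zero => rfl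
    | succ n ih =>
      simp only [Moore.stateSeq, ih, hI, t, Function.iterate_succ_apply']
  refine ⟨fun n => M.out (t n), fun n => ?_⟩
  rw [hst]
  exact (Set.inter_eq_left.2 (M.out_sub _)).symm

/-- Along a trace of `M`, the run of `A` paired with the states of `M` is reachable in the
product. -/
theorem prodReach_of_mem_traces {Oe O : Set AP} (huniv : Oe ∪ O = Set.univ) (A : DSA AP)
    (M : Moore AP Oe O) {γ : ℕ → Set AP} (hγ : γ ∈ M.Traces) (n : ℕ) :
    ProdReach Oe A.δ A.q0 M (A.run A.q0 γ n, M.stateSeq γ n) := by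
  induction n with
  | zero => exact .init
  | succ n ih =>
    have hletter : γ n ∩ Oe ∪ M.out (M.stateSeq γ n) = γ n := by
      rw [hγ n, ← Set.inter_union_distrib_left, huniv, Set.inter_univ]
    have hstep := ProdReach.step _ _ (γ n ∩ Oe) Set.inter_subset_right ih
    rwa [hletter] at hstep

theorem stmt_1 [Finite AP] (Oe Oc Op : Set AP)
    (hec : Disjoint Oe Oc) (hep : Disjoint Oe Op) (hcp : Disjoint Oc Op)
    (huniv : Oe ∪ Oc ∪ Op = Set.univ)
    (A : DSA AP)
    (Mp : Moore AP (Oe ∪ Oc) Op) (hadm : Admissible Mp A.Lang)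
    (Mc : Moore AP (Oe ∪ Op) Oc)
    (hcons : Consistent (safeUC Oe Oc Op A) Mp Mc) :
    (par Mp Mc).Sat A.Lang := by
  intro γ hγ n
  have huniv' : Oe ∪ (Op ∪ Oc) = Set.univ := by
    rw [Set.union_comm Op, ← Set.union_assoc, huniv]
  obtain ⟨Mc', -, hsafe⟩ :=
    hcons _ _ _ (prodReach_of_mem_traces huniv' A (par Mp Mc) hγ n)
  obtain ⟨γ', hγ'⟩ :=
    (par (Mp.reinit _) Mc').traces_nonempty (Set.disjoint_union_right.2 ⟨hep, hec⟩)
  exact hsafe _ ⟨γ', hγ', rfl⟩ 0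

end UCS
end

section
/- Let A = (Q, q0, δ, safe(F)) be a deterministic safety automaton over Σ, let q_s ∈ Q, and let α_s ∈ 2^{O_c}. There exists a tree automaton A' over 2^{O_p}-labeled 2^{I_p}-trees with exactly |Q| + 2 states whose language equals the safe prophecy: a plant M_p (identified with the tree γ ↦ out(M_p, γ)) is accepted by A' if and only if M_p ∈ S_A^{q_s, α_s}. -/
/- Common framework: Moore machines (strategies), parallel composition of a
plant and a controller, deterministic safety automata, runs, languages,
safe prophecies, universal controllers and consistency, tree automata. -/

namespace UCS

variable {AP : Type}

variable {AP : Type}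

/-- The run of a DSA on a trace with a letter prepended. -/
theorem DSA.run_cons (A : DSA AP) (q : A.Q) (a : Set AP) (γ : ℕ → Set AP) (n : ℕ) :
    A.run q (fun k => Nat.casesOn k a γ) (n + 1) = A.run (A.δ q a) γ n := by
  induction n with
  | zero => rfl
  | succ n ih =>
    change A.δ (A.run q _ (n + 1)) (γ n) = _
    rw [ih]
    rfl

namespace Moore

variable {I O : Set AP}

theorem stateSeq_cons (M : Moore AP I O) (a : Set AP) (γ : ℕ → Set AP) (n : ℕ) :
    M.stateSeq (fun k => Nat.casesOn k a γ) (n + 1) =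
      (M.reinit (M.tr M.s0 (a ∩ I))).stateSeq γ n := by
  induction n with
  | zero => rfl
  | succ n ih =>
    change M.tr (M.stateSeq _ (n + 1)) (γ n ∩ I) = _
    rw [ih]
    rfl

theorem traces_nonempty_s2 (M : Moore AP I O) (h : Disjoint I O) : M.Traces.Nonempty := by
  let st : ℕ → M.S := fun n => Nat.rec M.s0 (fun _ s => M.tr s ∅) n
  have hst : ∀ n, M.stateSeq (fun k => M.out (st k)) n = st n := by
    intro n
    induction n with
    | zero => rfl
    | succ n ih =>
      have hI : M.out (st n) ∩ I = ∅ :=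
        (h.symm.mono_left (M.out_sub _)).inter_eq
      change M.tr (M.stateSeq _ n) (M.out (st n) ∩ I) = M.tr (st n) ∅
      rw [ih, hI]
  refine ⟨fun k => M.out (st k), fun i => ?_⟩
  rw [hst i]
  exact (Set.inter_eq_left.mpr (M.out_sub _)).symm

/-- All runs of `A` from `q` on traces of `M` started in `s` are safe. -/
def SafeFrom (M : Moore AP I O) (A : DSA AP) (q : A.Q) (s : M.S) : Prop :=
  ∀ γ ∈ (M.reinit s).Traces, ∀ i, A.run q γ i ∈ A.F

theorem SafeFrom.mem {M : Moore AP I O} {A : DSA AP} {q : A.Q} {s : M.S}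
    (hs : M.SafeFrom A q s) (h : Disjoint I O) : q ∈ A.F := by
  obtain ⟨γ, hγ⟩ := (M.reinit s).traces_nonempty_s2 h
  exact hs γ hγ 0

theorem SafeFrom.step {M : Moore AP I O} {A : DSA AP} {q : A.Q} {s : M.S}
    (hs : M.SafeFrom A q s) (h : Disjoint I O) {σ : Set AP} (hσ : σ ⊆ I) :
    M.SafeFrom A (A.δ q (σ ∪ M.out s)) (M.tr s σ) := by
  intro γ hγ i
  have hI : (σ ∪ M.out s) ∩ I = σ := by
    rw [Set.union_inter_distrib_right, (h.symm.mono_left (M.out_sub s)).inter_eq,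
      Set.union_empty, Set.inter_eq_left.mpr hσ]
  have hO : (σ ∪ M.out s) ∩ O = M.out s := by
    rw [Set.union_inter_distrib_right, (h.mono_left hσ).inter_eq,
      Set.empty_union, Set.inter_eq_left.mpr (M.out_sub s)]
  rw [← A.run_cons]
  refine hs _ (fun k => ?_) (i + 1)
  cases k with
  | zero => exact hO.symm
  | succ k =>
    rw [stateSeq_cons]
    change M.out (((M.reinit s).reinit (M.tr s ((σ ∪ M.out s) ∩ I))).stateSeq γ k) = γ k ∩ O
    rw [hI]
    exact hγ k

end Moore

open Classical in
/-- The tree automaton recognizing the safe prophecy: it guesses the controller outputs, tracks `A`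
along the branches compatible with the guess, and accepts everything elsewhere. The state `none` is
the accepting sink and `some none` is the initial state, which stands for `qs` and admits only the
guess `αs`. -/
def prophecyAut (Oe Oc Op : Set AP) (A : DSA AP) (qs : A.Q) (αs : Set AP) :
    TreeAut AP (Oe ∪ Oc) Op where
  Q := Option (Option A.Q)
  fin := by haveI := A.fin; infer_instance
  q0 := some none
  T := {p | match p.1 with
    | none => ∀ β, p.2.2 β = none
    | some y => y.getD qs ∈ A.F ∧ ∃ α ⊆ Oc, (y = none → α = αs) ∧
        ∀ β, p.2.2 β =
          if β ∩ Oc = α then some (some (A.δ (y.getD qs) (β ∪ p.2.1))) else none}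
  Ω := Set.univ

/-- The controller that simulates the plant `Mp` and the automaton `A`, choosing its outputs
according to `c`. -/
def simController {Oe Oc Op : Set AP} [Finite AP] (A : DSA AP) (Mp : Moore AP (Oe ∪ Oc) Op)
    (c : Mp.S → A.Q → Set AP) (q : A.Q) (α : Set AP) :
    Moore AP (Oe ∪ Op) Oc where
  S := Mp.S × A.Q × Set AP
  fin := by haveI := Mp.fin; haveI := A.fin; infer_instance
  s0 := (Mp.s0, q, α)
  tr := fun p σ =>
    let s' := Mp.tr p.1 (σ ∩ Oe ∪ p.2.2 ∩ Oc)
    let q' := A.δ p.2.1 (σ ∩ Oe ∪ (Mp.out p.1 ∪ p.2.2 ∩ Oc))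
    (s', q', c s' q')
  out := fun p => p.2.2 ∩ Oc
  out_sub := fun _ => Set.inter_subset_right

/-- If `P s q α` guarantees safety of `q` and can be maintained by a choice of outputs `α`, then a
controller with first output `αs` keeps `A` safe. -/
theorem mem_safeProphecy_of_invariant [Finite AP] {Oe Oc Op : Set AP}
    (huniv : Oe ∪ Oc ∪ Op = Set.univ)
    {A : DSA AP} {qs : A.Q} {αs : Set AP} {Mp : Moore AP (Oe ∪ Oc) Op}
    (P : Mp.S → A.Q → Set AP → Prop)
    (hF : ∀ s q α, P s q α → q ∈ A.F) (hc : ∀ s q α, P s q α → α ⊆ Oc)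
    (hstep : ∀ s q α, P s q α → ∀ σ ⊆ Oe,
      ∃ α', P (Mp.tr s (σ ∪ α)) (A.δ q (σ ∪ (Mp.out s ∪ α))) α')
    (h0 : P Mp.s0 qs αs) : Mp ∈ safeProphecy Oe Oc Op A qs αs := by
  classical
  let c : Mp.S → A.Q → Set AP := fun s q => if h : ∃ α, P s q α then h.choose else ∅
  have hcP : ∀ s q, (∃ α, P s q α) → P s q (c s q) := by
    intro s q h
    simp only [c, dif_pos h]
    exact h.choose_spec
  let Mc := simController A Mp c qs αs
  refine ⟨Mc, Set.inter_eq_left.mpr (hc _ _ _ h0), ?_⟩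
  rintro ρ ⟨γ, hγ, rfl⟩
  have inv : ∀ n, ∃ s α, (par Mp Mc).stateSeq γ n = (s, (s, A.run qs γ n, α)) ∧
      P s (A.run qs γ n) α := by
    intro n
    induction n with
    | zero => exact ⟨Mp.s0, αs, rfl, h0⟩
    | succ n ih =>
      obtain ⟨s, α, hst, hP⟩ := ih
      have hα : α ∩ Oc = α := Set.inter_eq_left.mpr (hc _ _ _ hP)
      have hout : Mp.out s ∪ α = γ n ∩ (Op ∪ Oc) := by
        have := hγ n
        rw [hst] at this
        rw [← this]
        exact congrArg (Mp.out s ∪ ·) hα.symm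
      have hγn : γ n ∩ Oe ∪ (Mp.out s ∪ α) = γ n := by
        rw [hout, ← Set.inter_union_distrib_left]
        refine Set.inter_eq_left.mpr fun x _ => ?_
        have : x ∈ Oe ∪ Oc ∪ Op := huniv ▸ Set.mem_univ x
        simp only [Set.mem_union] at this ⊢
        tauto
      have hp : (γ n ∩ Oe ∪ α ∩ Oc) ∩ (Oe ∪ Oc) = γ n ∩ Oe ∪ α := by
        rw [hα]
        refine Set.inter_eq_left.mpr (Set.union_subset_union Set.inter_subset_right (hc _ _ _ hP))
      have hq : ((γ n ∩ Oe ∪ Mp.out s) ∩ (Oe ∪ Op)) ∩ Oe = γ n ∩ Oe := by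
        have hsub : Mp.out s ⊆ γ n := hγn ▸ fun x hx => Or.inr (Or.inl hx)
        ext x
        have := @hsub x
        simp only [Set.mem_inter_iff, Set.mem_union]
        tauto
      refine ⟨Mp.tr s (γ n ∩ Oe ∪ α), c (Mp.tr s (γ n ∩ Oe ∪ α)) (A.run qs γ (n + 1)),
        ?_, hcP _ _ ?_⟩
      · change (par Mp Mc).tr ((par Mp Mc).stateSeq γ n) (γ n ∩ Oe) = _
        rw [hst]
        change (Mp.tr s ((γ n ∩ Oe ∪ α ∩ Oc) ∩ (Oe ∪ Oc)),
          Mc.tr (s, A.run qs γ n, α) ((γ n ∩ Oe ∪ Mp.out s) ∩ (Oe ∪ Op))) = _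
        rw [hp]
        change (_, (Mp.tr s (((γ n ∩ Oe ∪ Mp.out s) ∩ (Oe ∪ Op)) ∩ Oe ∪ α ∩ Oc),
          A.δ (A.run qs γ n)
            (((γ n ∩ Oe ∪ Mp.out s) ∩ (Oe ∪ Op)) ∩ Oe ∪ (Mp.out s ∪ α ∩ Oc)), c _ _)) = _
        rw [hq, hα, hγn]
        rfl
      · have := hstep _ _ _ hP (γ n ∩ Oe) Set.inter_subset_right
        rwa [hγn] at this
  intro i
  obtain ⟨s, α, -, hP⟩ := inv i
  exact hF _ _ _ hP

theorem mem_safeProphecy_of_mem_lang [Finite AP] {Oe Oc Op : Set AP}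
    (hec : Disjoint Oe Oc) (huniv : Oe ∪ Oc ∪ Op = Set.univ)
    {A : DSA AP} {qs : A.Q} {αs : Set AP} {Mp : Moore AP (Oe ∪ Oc) Op}
    (h : (fun γ => Mp.outOf γ) ∈ (prophecyAut Oe Oc Op A qs αs).Lang) :
    Mp ∈ safeProphecy Oe Oc Op A qs αs := by
  obtain ⟨η, ⟨hη0, hη⟩, -⟩ := h
  let st : List (Set AP) → Mp.S := fun γ => γ.foldl (fun s a => Mp.tr s (a ∩ (Oe ∪ Oc))) Mp.s0
  let W : Mp.S → A.Q → Prop := fun s q =>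
    ∃ γ : List (Set AP), (∀ a ∈ γ, a ⊆ Oe ∪ Oc) ∧ st γ = s ∧ η γ = some (some q)
  let P : Mp.S → A.Q → Set AP → Prop := fun s q α =>
    q ∈ A.F ∧ α ⊆ Oc ∧
      ∀ σ ⊆ Oe, W (Mp.tr s (σ ∪ α)) (A.δ q (σ ∪ (Mp.out s ∪ α)))
  have key : ∀ (γ : List (Set AP)) (y : Option A.Q), (∀ a ∈ γ, a ⊆ Oe ∪ Oc) → η γ = some y →
      ∃ α, P (st γ) (y.getD qs) α ∧ (y = none → α = αs) := by
    intro γ y hγ hy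
    obtain ⟨f, hT, hf⟩ := hη γ hγ
    rw [hy] at hT
    obtain ⟨hF, α, hα, hαs, hfα⟩ := hT
    refine ⟨α, ⟨hF, hα, fun σ hσ => ?_⟩, hαs⟩
    have hsub : σ ∪ α ⊆ Oe ∪ Oc := Set.union_subset_union hσ hα
    have hOc : (σ ∪ α) ∩ Oc = α := by
      rw [Set.union_inter_distrib_right, (hec.mono_left hσ).inter_eq, Set.empty_union,
        Set.inter_eq_left.mpr hα]
    refine ⟨γ ++ [σ ∪ α], ?_, ?_, ?_⟩
    · intro a ha
      rcases List.mem_append.mp ha with ha | ha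
      · exact hγ a ha
      · rw [List.mem_singleton.mp ha]
        exact hsub
    · simp only [st, List.foldl_append, List.foldl_cons, List.foldl_nil]
      rw [Set.inter_eq_left.mpr hsub]
    · have hu : σ ∪ α ∪ Mp.out (st γ) = σ ∪ (Mp.out (st γ) ∪ α) := by
        rw [Set.union_assoc, Set.union_comm α]
      rw [← hu]
      exact (hf _ hsub).trans ((hfα _).trans (if_pos hOc))
  refine mem_safeProphecy_of_invariant huniv P (fun _ _ _ h => h.1) (fun _ _ _ h => h.2.1) ?_ ?_
  · intro s q α hP σ hσ
    obtain ⟨γ, hγ, hs, hq⟩ := hP.2.2 σ hσ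
    obtain ⟨α', hα', -⟩ := key γ _ hγ hq
    rw [hs] at hα'
    exact ⟨α', hα'⟩
  · obtain ⟨α, hα, hαs⟩ := key [] none (by simp) hη0
    exact hαs rfl ▸ hα

open Classical in
theorem mem_lang_of_mem_safeProphecy {Oe Oc Op : Set AP}
    (hec : Disjoint Oe Oc) (hep : Disjoint Oe Op)
    {A : DSA AP} {qs : A.Q} {αs : Set AP} {Mp : Moore AP (Oe ∪ Oc) Op}
    (h : Mp ∈ safeProphecy Oe Oc Op A qs αs) :
    (fun γ => Mp.outOf γ) ∈ (prophecyAut Oe Oc Op A qs αs).Lang := by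
  obtain ⟨Mc, hMc, hsafe⟩ := h
  have hdisj : Disjoint Oe (Op ∪ Oc) := Set.disjoint_union_right.mpr ⟨hep, hec⟩
  let step : Option (Option A.Q) × (Mp.S × Mc.S) → Set AP → Option (Option A.Q) × (Mp.S × Mc.S) :=
    fun p β =>
      (p.1.bind fun y => if β ∩ Oc = Mc.out p.2.2 then
          some (some (A.δ (y.getD qs) (β ∪ Mp.out p.2.1))) else none,
        Mp.tr p.2.1 (β ∩ (Oe ∪ Oc)),
        Mc.tr p.2.2 ((β ∩ Oe ∪ Mp.out p.2.1) ∩ (Oe ∪ Op)))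
  let st : List (Set AP) → Option (Option A.Q) × (Mp.S × Mc.S) :=
    fun γ => γ.foldl step (some none, (Mp.s0, Mc.s0))
  have st_append : ∀ γ β, st (γ ++ [β]) = step (st γ) β := by
    intro γ β
    simp only [st, List.foldl_append, List.foldl_cons, List.foldl_nil]
  have hfold : ∀ γ : List (Set AP),
      (st γ).2.1 = γ.foldl (fun s a => Mp.tr s (a ∩ (Oe ∪ Oc))) Mp.s0 := by
    intro γ
    induction γ using List.reverseRecOn with
    | nil => rfl
    | append_singleton γ β ih =>
      rw [st_append, List.foldl_append, ← ih]
      rfl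
  have inv : ∀ γ : List (Set AP), (∀ a ∈ γ, a ⊆ Oe ∪ Oc) →
      ∀ y, (st γ).1 = some y →
        (y = none → Mc.out (st γ).2.2 = αs) ∧
        (par Mp Mc).SafeFrom A (y.getD qs) (st γ).2 := by
    intro γ
    induction γ using List.reverseRecOn with
    | nil =>
      intro _ y hy
      obtain rfl : none = y := Option.some.inj hy
      exact ⟨fun _ => hMc, fun γ hγ => hsafe _ ⟨γ, hγ, rfl⟩⟩
    | append_singleton γ β ih =>
      intro hγ
      have hst := ih fun a ha => hγ a (List.mem_append_left _ ha)
      have hβ : β ⊆ Oe ∪ Oc := hγ β (by simp)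
      rw [st_append]
      intro y hy
      obtain ⟨z, hz, hy⟩ := Option.bind_eq_some_iff.mp hy
      split_ifs at hy with hβc
      obtain rfl := Option.some.inj hy
      refine ⟨nofun, ?_⟩
      have hsafe' := (hst z hz).2.step hdisj (Set.inter_subset_right : β ∩ Oe ⊆ Oe)
      have hβeq : β ∩ Oe ∪ Mc.out (st γ).2.2 = β := by
        rw [← hβc, ← Set.inter_union_distrib_left, Set.inter_eq_left.mpr hβ]
      have hletter : β ∩ Oe ∪ (Mp.out (st γ).2.1 ∪ Mc.out (st γ).2.2) =
          β ∪ Mp.out (st γ).2.1 := by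
        rw [Set.union_comm (Mp.out _), ← Set.union_assoc, hβeq]
      change (par Mp Mc).SafeFrom A
        (A.δ (z.getD qs) (β ∩ Oe ∪ (Mp.out (st γ).2.1 ∪ Mc.out (st γ).2.2)))
        (Mp.tr (st γ).2.1 ((β ∩ Oe ∪ Mc.out (st γ).2.2) ∩ (Oe ∪ Oc)),
          Mc.tr (st γ).2.2 ((β ∩ Oe ∪ Mp.out (st γ).2.1) ∩ (Oe ∪ Op))) at hsafe'
      rwa [hletter, hβeq] at hsafe'
  refine ⟨fun γ => (st γ).1, ⟨rfl, fun γ hγ => ?_⟩, fun _ _ => Set.mem_univ _⟩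
  have hst := inv γ hγ
  refine ⟨fun β => (step (st γ) β).1, ?_, fun β _ => congrArg Prod.fst (st_append γ β)⟩
  change ((st γ).1, Mp.outOf γ, fun β => (step (st γ) β).1) ∈ (prophecyAut Oe Oc Op A qs αs).T
  rw [Moore.outOf, ← hfold]
  cases hx : (st γ).1 with
  | none =>
    intro β
    change (st γ).1.bind _ = none
    rw [hx]
    rfl
  | some y =>
    obtain ⟨hinit, hs⟩ := hst y hx
    refine ⟨hs.mem hdisj, Mc.out (st γ).2.2, Mc.out_sub _, hinit, fun β => ?_⟩
    change (st γ).1.bind _ = _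
    rw [hx]
    rfl

theorem stmt_2 [Finite AP] (Oe Oc Op : Set AP)
    (hec : Disjoint Oe Oc) (hep : Disjoint Oe Op) (hcp : Disjoint Oc Op)
    (huniv : Oe ∪ Oc ∪ Op = Set.univ)
    (A : DSA AP)
    (qs : A.Q) (αs : Set AP) (hαs : αs ⊆ Oc) :
    ∃ A' : TreeAut AP (Oe ∪ Oc) Op,
      Nat.card A'.Q = Nat.card A.Q + 2 ∧
      ∀ Mp : Moore AP (Oe ∪ Oc) Op,
        (fun γ => Mp.outOf γ) ∈ A'.Lang ↔ Mp ∈ safeProphecy Oe Oc Op A qs αs := by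
  have := A.fin
  refine ⟨prophecyAut Oe Oc Op A qs αs, ?_, fun Mp =>
    ⟨mem_safeProphecy_of_mem_lang hec huniv, mem_lang_of_mem_safeProphecy hec hep⟩⟩
  change Nat.card (Option (Option A.Q)) = _
  rw [Finite.card_option, Finite.card_option]

end UCS
end

section
/- Let A = (Q, q0, δ, safe(F)) be a deterministic safety automaton over Σ, let q ∈ Q, α ∈ 2^{O_c}, and let M_p = (S_p, s0_p, τ_p, o_p) be a plant with M_p ∈ S_A^{q,α}. Then for every environment output β_e ∈ 2^{O_e}, setting q' = δ(q, α ∪ o_p(s0_p) ∪ β_e) and letting M_p' be the plant M_p with its initial state replaced by τ_p(s0_p, (α ∪ β_e) ∩ I_p), there exists a controller output α' ∈ 2^{O_c} such that M_p' ∈ S_A^{q', α'}. (Hence the on-the-fly composition of the safe-prophecy universal controller with any plant satisfying a current prophecy can always proceed for one more step.) -/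
/- Common framework: Moore machines (strategies), parallel composition of a
plant and a controller, deterministic safety automata, runs, languages,
safe prophecies, universal controllers and consistency, tree automata. -/

namespace UCS

variable {AP : Type}

variable {AP : Type}

/-- The word `a · γ` obtained by prepending the letter `a` to `γ`. -/
def consSeq {β : Type} (a : β) (γ : ℕ → β) : ℕ → β
  | 0 => a
  | n + 1 => γ n

theorem Moore.stateSeq_consSeq {I O : Set AP} (M : Moore AP I O) (a : Set AP)
    (γ : ℕ → Set AP) (n : ℕ) :
    M.stateSeq (consSeq a γ) (n + 1) =
      (M.reinit (M.tr M.s0 (a ∩ I))).stateSeq γ n := by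
  induction n with
  | zero => rfl
  | succ n ih =>
    rw [Moore.stateSeq, ih]
    rfl

theorem Moore.consSeq_mem_traces {I O : Set AP} (M : Moore AP I O) {a : Set AP}
    {γ : ℕ → Set AP} (ha : M.out M.s0 = a ∩ O)
    (hγ : γ ∈ (M.reinit (M.tr M.s0 (a ∩ I))).Traces) :
    consSeq a γ ∈ M.Traces
  | 0 => ha
  | n + 1 => by
    rw [M.stateSeq_consSeq]
    exact hγ n

theorem DSA.run_consSeq (A : DSA AP) (q : A.Q) (a : Set AP) (γ : ℕ → Set AP)
    (n : ℕ) : A.run q (consSeq a γ) (n + 1) = A.run (A.δ q a) γ n := by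
  induction n with
  | zero => rfl
  | succ n ih =>
    rw [DSA.run, ih]
    rfl

/-- One step of a machine all of whose runs are accepting leads to a machine all
of whose runs are accepting. -/
theorem DSA.accepting_runs_reinit {I O : Set AP} (A : DSA AP) (q : A.Q)
    (M : Moore AP I O) (hM : ∀ ρ ∈ A.Runs q M, ∀ i, ρ i ∈ A.F) {a : Set AP}
    (ha : M.out M.s0 = a ∩ O) :
    ∀ ρ ∈ A.Runs (A.δ q a) (M.reinit (M.tr M.s0 (a ∩ I))), ∀ i, ρ i ∈ A.F := by
  rintro _ ⟨γ, hγ, rfl⟩ i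
  rw [← A.run_consSeq]
  exact hM _ ⟨_, M.consSeq_mem_traces ha hγ, rfl⟩ (i + 1)

theorem stmt_9 [Finite AP] (Oe Oc Op : Set AP)
    (hec : Disjoint Oe Oc) (hep : Disjoint Oe Op) (hcp : Disjoint Oc Op)
    (huniv : Oe ∪ Oc ∪ Op = Set.univ)
    (A : DSA AP)
    (q : A.Q) (α : Set AP) (hα : α ⊆ Oc)
    (Mp : Moore AP (Oe ∪ Oc) Op) (hMp : Mp ∈ safeProphecy Oe Oc Op A q α)
    (βe : Set AP) (hβe : βe ⊆ Oe) :
    ∃ α' : Set AP, α' ⊆ Oc ∧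
      Mp.reinit (Mp.tr Mp.s0 ((α ∪ βe) ∩ (Oe ∪ Oc))) ∈
        safeProphecy Oe Oc Op A (A.δ q (α ∪ Mp.out Mp.s0 ∪ βe)) α' := by
  obtain ⟨Mc, rfl, hacc⟩ := hMp
  set α := Mc.outOf []
  have hop : Mp.out Mp.s0 ⊆ Op := Mp.out_sub _
  let a := α ∪ Mp.out Mp.s0 ∪ βe
  have haO : (par Mp Mc).out (par Mp Mc).s0 = a ∩ (Op ∪ Oc) := by
    change Mp.out Mp.s0 ∪ α = a ∩ (Op ∪ Oc)
    grind
  have hae : a ∩ Oe = βe := by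
    grind
  let sc := Mc.tr Mc.s0 ((βe ∪ Mp.out Mp.s0) ∩ (Oe ∪ Op))
  refine ⟨Mc.out sc, Mc.out_sub sc, Mc.reinit sc, rfl, ?_⟩
  have h := A.accepting_runs_reinit q (par Mp Mc) hacc haO
  rw [hae] at h
  rw [Set.union_comm α βe]
  exact h

end UCS
end
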